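/- Let p be a prime with p ≡ 1 (mod 4) and let m > 1 be an odd integer coprime to p such that −1 and p are squares modulo m, and let q be a prime power dividing m with q ≠ m. In the non-bipartite LPS Ramanujan graph X_{p,m} on PSL₂(ZMod m), at least one of the graph distances from the class of the identity to the class Ī′ of ![![1,q],![0,1]] and to the class W̄ of ![![0,1],![−1,0]] is ≥ log_p(q⁴/4); consequently the diameter of X_{p,m} satisfies (diam : ℝ) ≥ log_p(q⁴/4). -/

import Mathlib

open Matrix
open scoped Quaternion

namespace Quaternion

/-- The integral quaternion with the given coordinates. -/
def ofCoords (x y z w : ℤ) : ℍ[ℤ] := ⟨x, y, z, w⟩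

@[simp] theorem re_ofCoords (x y z w : ℤ) : (ofCoords x y z w).re = x := rfl

@[simp] theorem imI_ofCoords (x y z w : ℤ) : (ofCoords x y z w).imI = y := rfl

@[simp] theorem imJ_ofCoords (x y z w : ℤ) : (ofCoords x y z w).imJ = z := rfl

@[simp] theorem imK_ofCoords (x y z w : ℤ) : (ofCoords x y z w).imK = w := rfl

/-- An integral quaternion congruent to `1` modulo `2`. -/
def IsOneModTwo (a : ℍ[ℤ]) : Prop :=
  Odd a.re ∧ Even a.imI ∧ Even a.imJ ∧ Even a.imK

theorem IsOneModTwo.one : IsOneModTwo 1 := by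
  simp [IsOneModTwo]

theorem IsOneModTwo.star {a : ℍ[ℤ]} (ha : IsOneModTwo a) : IsOneModTwo (star a) := by
  simpa [IsOneModTwo] using ha

theorem IsOneModTwo.mul {a b : ℍ[ℤ]} (ha : IsOneModTwo a) (hb : IsOneModTwo b) :
    IsOneModTwo (a * b) := by
  obtain ⟨h0, h1, h2, h3⟩ := ha
  obtain ⟨k0, k1, k2, k3⟩ := hb
  simp only [IsOneModTwo, re_mul, imI_mul, imJ_mul, imK_mul]
  simp only [← Int.not_even_iff_odd] at *
  simp [h0, h1, h2, h3, k0, k1, k2, k3, parity_simps]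

theorem IsOneModTwo.of_natCast_mul {n : ℕ} {a : ℍ[ℤ]} (h : IsOneModTwo ((n : ℍ[ℤ]) * a))
    (hn : Odd n) :
    IsOneModTwo a := by
  have hn' : ¬ Even (n : ℤ) := by simpa [Int.not_even_iff_odd] using hn
  simpa [IsOneModTwo, re_mul, imI_mul, imJ_mul, imK_mul, Int.odd_mul, Int.even_mul, hn',
    Int.not_even_iff_odd.1 hn'] using h

theorem dvd_of_dvd_natCast_mul {p k : ℕ} (h : p.Coprime k) {a : ℍ[ℤ]}
    (ha : (p : ℍ[ℤ]) ∣ k * a) : (p : ℍ[ℤ]) ∣ a := by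
  obtain ⟨b, hb⟩ := ha
  obtain ⟨u, v, huv⟩ := Nat.isCoprime_iff_coprime.2 h
  refine ⟨u * a + v * b, ?_⟩
  have huv' : (u : ℍ[ℤ]) * p + v * k = 1 := by exact_mod_cast congrArg (Int.cast : ℤ → ℍ[ℤ]) huv
  calc a = (u * p + v * k) * a := by rw [huv', one_mul]
    _ = u * p * a + v * (k * a) := by rw [add_mul, mul_assoc (v : ℍ[ℤ])]
    _ = p * (u * a + v * b) := by
      rw [hb, mul_add, ← mul_assoc, ← mul_assoc, ← mul_assoc, (Nat.cast_commute p _).eq,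
        (Nat.cast_commute p _).eq]

theorem normSq_natCast_mul (n : ℕ) (a : ℍ[ℤ]) : normSq ((n : ℍ[ℤ]) * a) = n ^ 2 * normSq a := by
  rw [map_mul, normSq_natCast]

theorem exists_normSq_eq_two_mul_eq_two_mul {a : ℍ[ℤ]} (h : Even (normSq a)) :
    ∃ u b : ℍ[ℤ], normSq u = 2 ∧ u * a = (2 : ℕ) * b := by
  have key : ∀ u : ℍ[ℤ], normSq u = 2 → Even (u * a).re → Even (u * a).imI →
      Even (u * a).imJ → Even (u * a).imK →
      ∃ u b : ℍ[ℤ], normSq u = 2 ∧ u * a = (2 : ℕ) * b := by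
    rintro u hu ⟨x, hx⟩ ⟨y, hy⟩ ⟨z, hz⟩ ⟨w, hw⟩
    refine ⟨u, ofCoords x y z w, hu, ?_⟩
    ext
    · rw [hx]; simp [two_mul]
    · rw [hy]; simp [two_mul]
    · rw [hz]; simp [two_mul]
    · rw [hw]; simp [two_mul]
  have h1 := key (ofCoords 1 1 0 0) (by simp [normSq_def'])
  have h2 := key (ofCoords 1 0 1 0) (by simp [normSq_def'])
  have h3 := key (ofCoords 1 0 0 1) (by simp [normSq_def'])
  simp only [normSq_def'] at h
  simp only [re_mul, imI_mul, imJ_mul, imK_mul] at h1 h2 h3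
  simp only [parity_simps] at h h1 h2 h3
  by_cases a0 : Even a.re <;> by_cases a1 : Even a.imI <;> by_cases a2 : Even a.imJ <;>
    by_cases a3 : Even a.imK <;> simp [a0, a1, a2, a3] at h h1 h2 h3 ⊢ <;> assumption

theorem _root_.Int.exists_dvd_sub_four_mul_sq_lt {k : ℕ} (hk : Odd k) (x : ℤ) :
    ∃ y z : ℤ, x = y + k * z ∧ 4 * y ^ 2 < (k : ℤ) ^ 2 := by
  obtain ⟨j, rfl⟩ := hk
  have hpos : (0 : ℤ) < ((2 * j + 1 : ℕ) : ℤ) := by positivity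
  have h1 := Int.emod_nonneg (x + j) hpos.ne'
  have h2 := Int.emod_lt_of_pos (x + j) hpos
  have h3 := Int.mul_ediv_add_emod (x + j) ((2 * j + 1 : ℕ) : ℤ)
  refine ⟨(x + j) % ((2 * j + 1 : ℕ) : ℤ) - j, (x + j) / ((2 * j + 1 : ℕ) : ℤ), by linarith, ?_⟩
  generalize (x + j) % ((2 * j + 1 : ℕ) : ℤ) = r at h1 h2
  push_cast at *
  nlinarith

theorem exists_sub_natCast_mul_normSq_lt {k : ℕ} (hk : Odd k) (a : ℍ[ℤ]) :
    ∃ b c : ℍ[ℤ], a = b + k * c ∧ normSq b < (k : ℤ) ^ 2 := by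
  obtain ⟨y0, z0, h0, l0⟩ := Int.exists_dvd_sub_four_mul_sq_lt hk a.re
  obtain ⟨y1, z1, h1, l1⟩ := Int.exists_dvd_sub_four_mul_sq_lt hk a.imI
  obtain ⟨y2, z2, h2, l2⟩ := Int.exists_dvd_sub_four_mul_sq_lt hk a.imJ
  obtain ⟨y3, z3, h3, l3⟩ := Int.exists_dvd_sub_four_mul_sq_lt hk a.imK
  refine ⟨ofCoords y0 y1 y2 y3, ofCoords z0 z1 z2 z3, ?_, ?_⟩
  · apply Quaternion.ext
    · simp [h0]
    · simp [h1]
    · simp [h2]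
    · simp [h3]
  · rw [normSq_def']
    simp only [re_ofCoords, imI_ofCoords, imJ_ofCoords, imK_ofCoords]
    linarith

/-- Lagrange's descent inside the left ideal of those `b` with `p ∣ a * star b`. -/
theorem exists_normSq_eq_of_normSq_eq_mul {p : ℕ} (hp : p.Prime) (hp2 : Odd p) (a : ℍ[ℤ]) :
    ∀ (k : ℕ) (b : ℍ[ℤ]), 0 < k → k < p → normSq b = k * p → (p : ℍ[ℤ]) ∣ a * star b →
      ∃ c : ℍ[ℤ], normSq c = p ∧ (p : ℍ[ℤ]) ∣ a * star c := by
  intro k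
  induction k using Nat.strong_induction_on with
  | _ k ih =>
  intro b hk0 hkp hb hab
  rcases Nat.even_or_odd k with hk | hk
  · obtain ⟨j, rfl⟩ := hk
    obtain ⟨u, c, hu, hc⟩ := exists_normSq_eq_two_mul_eq_two_mul (a := b)
      (by rw [hb]; push_cast; exact ⟨j * p, by ring⟩)
    refine ih j (by omega) c (by omega) (by omega) ?_ ?_
    · have := congrArg normSq hc
      rw [map_mul, hu, hb, normSq_natCast_mul] at this
      push_cast at this
      linarith
    · refine dvd_of_dvd_natCast_mul (k := 2) (Nat.coprime_two_right.2 hp2) ?_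
      have h1 : ((2 : ℕ) : ℍ[ℤ]) * (a * star c) = a * star b * star u := by
        have := congrArg star hc
        rw [star_mul, star_mul, star_natCast] at this
        rw [mul_assoc a, this, (Nat.cast_commute 2 _).eq, mul_assoc]
      rw [h1]
      exact Dvd.dvd.mul_right hab _
  · rcases Nat.lt_or_ge 1 k with hk1 | hk1
    swap
    · obtain rfl : k = 1 := by omega
      exact ⟨b, by simpa using hb, hab⟩
    obtain ⟨d, c, hbd, hd⟩ := exists_sub_natCast_mul_normSq_lt hk b
    have hdk : star d * b = k * (p - star c * b) := by
      have : star d = star b - k * star c := by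
        rw [hbd, star_add, star_mul, star_natCast, (Nat.cast_commute k _).eq]; abel
      rw [this, sub_mul, star_mul_self, hb, mul_sub, mul_assoc]
      push_cast
      rfl
    have hkne : (k : ℤ) ≠ 0 := by positivity
    have hdvd : (k : ℤ) ∣ normSq d := by
      have : d = b + k * (-c) := by rw [hbd]; simp
      rw [this, normSq_add, hb, normSq_natCast_mul]
      have h2 : (b * star ((k : ℍ[ℤ]) * -c)).re = k * (b * star (-c)).re := by
        rw [star_mul, star_natCast, ← mul_assoc, ← (Nat.cast_commute k _).eq, re_mul]; simp
      rw [h2]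
      exact ⟨p + k * normSq (-c) + 2 * (b * star (-c)).re, by ring⟩
    obtain ⟨k', hk'⟩ := hdvd
    have hk'0 : 0 ≤ k' := by
      have h0 : 0 ≤ normSq d := normSq_nonneg
      rw [hk'] at h0
      exact nonneg_of_mul_nonneg_right h0 (by positivity)
    lift k' to ℕ using hk'0
    have hnorm : normSq (p - star c * b : ℍ[ℤ]) = k' * p := by
      have := congrArg normSq hdk
      rw [map_mul, normSq_star, hk', hb, normSq_natCast_mul] at this
      exact mul_left_cancel₀ (pow_ne_zero 2 hkne) (by rw [← this]; ring)
    have hk'k : k' < k := by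
      rw [hk', sq] at hd
      exact_mod_cast lt_of_mul_lt_mul_left hd (by positivity)
    refine ih k' hk'k (p - star c * b) ?_ (hk'k.trans hkp) hnorm ?_
    · rcases Nat.eq_zero_or_pos k' with rfl | h
      · exfalso
        have hd0 : d = 0 := normSq_eq_zero.1 (by rw [hk']; simp)
        rw [hd0, zero_add] at hbd
        rw [hbd, normSq_natCast_mul, sq, mul_assoc] at hb
        have hb' := mul_left_cancel₀ hkne hb
        have : k ∣ p := by exact_mod_cast Dvd.intro _ hb'
        rcases (Nat.dvd_prime hp).1 this with h | h <;> omega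
      · exact h
    · rw [star_sub, star_natCast, star_mul, star_star, mul_sub, ← mul_assoc]
      exact dvd_sub ⟨a, (Nat.cast_commute p a).eq.symm⟩
        (Dvd.dvd.mul_right hab _)

theorem exists_normSq_eq_of_dvd_normSq {p : ℕ} (hp : p.Prime) (hp2 : Odd p) {a : ℍ[ℤ]}
    (h : (p : ℤ) ∣ normSq a) (ha : ¬ (p : ℍ[ℤ]) ∣ a) :
    ∃ c : ℍ[ℤ], normSq c = p ∧ (p : ℍ[ℤ]) ∣ a * star c := by
  obtain ⟨d, c, had, hd⟩ := exists_sub_natCast_mul_normSq_lt hp2 a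
  have hdvd : (p : ℍ[ℤ]) ∣ a * star d := by
    have : star d = star a - p * star c := by
      rw [had, star_add, star_mul, star_natCast, (Nat.cast_commute p _).eq]; abel
    rw [this, mul_sub, self_mul_star]
    obtain ⟨n, hn⟩ := h
    refine dvd_sub ⟨n, by rw [hn]; push_cast; rfl⟩ ?_
    rw [← mul_assoc, ← (Nat.cast_commute p a).eq, mul_assoc]
    exact dvd_mul_right _ _
  have hpd : (p : ℤ) ∣ normSq d := by
    have : d = a + p * (-c) := by rw [had]; simp
    rw [this, normSq_add, normSq_natCast_mul]
    have h2 : (a * star ((p : ℍ[ℤ]) * -c)).re = p * (a * star (-c)).re := by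
      rw [star_mul, star_natCast, ← mul_assoc, ← (Nat.cast_commute p _).eq, re_mul]; simp
    rw [h2]
    refine dvd_add (dvd_add h ⟨p * normSq (-c), by ring⟩) ⟨2 * (a * star (-c)).re, by ring⟩
  obtain ⟨k, hk⟩ := hpd
  have hppos : (0 : ℤ) < p := by exact_mod_cast hp.pos
  have hk0 : 0 < k := by
    have h0 : 0 ≤ normSq d := normSq_nonneg
    have h1 : normSq d ≠ 0 := by
      rw [normSq_ne_zero]
      rintro rfl
      exact ha ⟨c, by rw [had, zero_add]⟩
    have h2 : 0 < normSq d := lt_of_le_of_ne h0 h1.symm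
    rw [hk] at h2
    exact pos_of_mul_pos_right h2 hppos.le
  lift k to ℕ using hk0.le
  refine exists_normSq_eq_of_normSq_eq_mul hp hp2 a k d (by exact_mod_cast hk0) ?_
    (by rw [hk, mul_comm]) hdvd
  rw [hk, sq] at hd
  exact_mod_cast lt_of_mul_lt_mul_left hd hppos.le

theorem exists_unit_mul_isOneModTwo {a : ℍ[ℤ]} (h : normSq a % 4 = 1) :
    ∃ u : ℍ[ℤ], normSq u = 1 ∧ IsOneModTwo (u * a) ∧ 0 < (u * a).re := by
  by_contra hcon
  have key : ∀ u : ℍ[ℤ], normSq u = 1 → ¬ IsOneModTwo (u * a) := by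
    intro u hu hua
    apply hcon
    rcases lt_trichotomy 0 (u * a).re with h0 | h0 | h0
    · exact ⟨u, hu, hua, h0⟩
    · have := hua.1
      simp [← h0] at this
    · refine ⟨-u, by rw [normSq_neg, hu], ?_, by rw [neg_mul]; simpa using h0⟩
      rw [neg_mul]
      simpa only [IsOneModTwo, re_neg, imI_neg, imJ_neg, imK_neg, odd_neg, even_neg] using hua
  have h0 := key (ofCoords 1 0 0 0) (by simp [normSq_def'])
  have h1 := key (ofCoords 0 1 0 0) (by simp [normSq_def'])
  have h2 := key (ofCoords 0 0 1 0) (by simp [normSq_def'])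
  have h3 := key (ofCoords 0 0 0 1) (by simp [normSq_def'])
  simp only [normSq_def'] at h
  simp only [IsOneModTwo, re_mul, imI_mul, imJ_mul, imK_mul] at h0 h1 h2 h3
  simp only [← Int.not_even_iff_odd, parity_simps] at h0 h1 h2 h3
  have sq_emod (x : ℤ) : x ^ 2 % 4 = if Even x then 0 else 1 := by
    split_ifs with hx
    · obtain ⟨y, rfl⟩ := hx
      ring_nf
      omega
    · obtain ⟨y, rfl⟩ := Int.not_even_iff_odd.1 hx
      ring_nf
      omega
  by_cases a0 : Even a.re <;> by_cases a1 : Even a.imI <;> by_cases a2 : Even a.imJ <;>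
    by_cases a3 : Even a.imK <;> simp [a0, a1, a2, a3] at h0 h1 h2 h3
  all_goals
    have e0 := sq_emod a.re
    have e1 := sq_emod a.imI
    have e2 := sq_emod a.imJ
    have e3 := sq_emod a.imK
    simp only [a0, a1, a2, a3, if_true, if_false] at e0 e1 e2 e3
    omega

/-- Splitting off a right factor of norm `p`. -/
theorem exists_right_factor {p : ℕ} (hp : p.Prime) (hp4 : p % 4 = 1) {a : ℍ[ℤ]}
    (h2 : IsOneModTwo a) (h : (p : ℤ) ∣ normSq a) (ha : ¬ (p : ℍ[ℤ]) ∣ a) :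
    ∃ b c : ℍ[ℤ], a = b * c ∧ IsOneModTwo b ∧ IsOneModTwo c ∧ 0 < c.re ∧ normSq c = p := by
  have hodd : Odd p := Nat.odd_iff.2 (by omega)
  obtain ⟨c, hc, hac⟩ := exists_normSq_eq_of_dvd_normSq hp hodd h ha
  obtain ⟨u, hu, huc, hpos⟩ := exists_unit_mul_isOneModTwo (a := c) (by rw [hc]; omega)
  have hnorm : normSq (u * c) = p := by rw [map_mul, hu, one_mul, hc]
  have hdvd : (p : ℍ[ℤ]) ∣ a * star (u * c) := by
    rw [star_mul, ← mul_assoc]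
    exact Dvd.dvd.mul_right hac _
  obtain ⟨b, hb⟩ := hdvd
  refine ⟨b, u * c, ?_, ?_, huc, hpos, hnorm⟩
  · have h1 : a * star (u * c) * (u * c) = p * (b * (u * c)) := by rw [hb, mul_assoc]
    rw [mul_assoc, star_mul_self, hnorm] at h1
    have h1' : (p : ℍ[ℤ]) * a = p * (b * (u * c)) := by
      rw [← h1, (Nat.cast_commute p a).eq]
      rfl
    have hp0 : (p : ℍ[ℤ]) ≠ 0 := fun h0 ↦ by
      simpa [hp.ne_zero] using congrArg QuaternionAlgebra.re h0
    exact mul_left_cancel₀ hp0 h1'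
  · exact IsOneModTwo.of_natCast_mul (hb ▸ h2.mul huc.star) hodd

end Quaternion

theorem Nat.exists_eq_mul_dvd_pow_coprime (m : ℕ) {y : ℕ} (hy : y ≠ 0) :
    ∃ r t K : ℕ, y = r * t ∧ r ∣ m ^ K ∧ t.Coprime m := by
  induction y using Nat.strong_induction_on with
  | _ y ih =>
  by_cases h : y.Coprime m
  · exact ⟨1, y, 0, by simp, by simp, h⟩
  · obtain ⟨y', hy'⟩ := Nat.gcd_dvd_left y m
    have hg : 1 < y.gcd m := by
      have h0 : y.gcd m ≠ 0 := fun h0 ↦ hy (Nat.eq_zero_of_gcd_eq_zero_left h0)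
      have h1 : y.gcd m ≠ 1 := h
      omega
    have hy'0 : y' ≠ 0 := by
      rintro rfl
      exact hy (by rw [hy', mul_zero])
    have hlt : y' < y := by
      calc y' < y.gcd m * y' := lt_mul_left (Nat.pos_of_ne_zero hy'0) hg
        _ = y := hy'.symm
    obtain ⟨r, t, K, h1, h2, h3⟩ := ih y' hlt hy'0
    refine ⟨y.gcd m * r, t, K + 1, ?_, ?_, h3⟩
    · rw [mul_assoc, ← h1, ← hy']
    · rw [pow_succ, mul_comm (m ^ K)]
      exact mul_dvd_mul (Nat.gcd_dvd_right y m) h2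

theorem Int.exists_pow_dvd_sq_add_one {m I₀ : ℤ} (hm : Odd m) (h : m ∣ I₀ ^ 2 + 1) (K : ℕ) :
    ∃ I : ℤ, m ^ (K + 1) ∣ I ^ 2 + 1 ∧ m ∣ I - I₀ := by
  induction K with
  | zero => exact ⟨I₀, by simpa using h, by simp⟩
  | succ K ih =>
    obtain ⟨I, ⟨c, hc⟩, hI⟩ := ih
    have hcop : IsCoprime (2 * I) m := by
      refine IsCoprime.mul_left ?_ ⟨-I, m ^ K * c, by linear_combination -hc⟩
      obtain ⟨j, rfl⟩ := hm
      exact ⟨-j, 1, by ring⟩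
    obtain ⟨v, u, huv⟩ := hcop
    refine ⟨I + m ^ (K + 1) * (-c * v), ⟨c * u + m ^ K * (c * v) ^ 2, ?_⟩, ?_⟩
    · linear_combination hc - c * m ^ (K + 1) * huv
    · have : m ∣ m ^ (K + 1) * (-c * v) := Dvd.dvd.mul_right (dvd_pow_self m (by simp)) _
      simpa [add_sub_right_comm] using dvd_add hI this

/-- If `I` is a square root of `-1` modulo `r`, then `r = g² + h²` with `g ≡ I h` modulo `r`. -/
theorem Int.exists_sq_add_sq_eq_of_dvd_sq_add_one (r : ℕ) (hr : 0 < r) (I : ℤ)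
    (h : (r : ℤ) ∣ I ^ 2 + 1) :
    ∃ g h : ℤ, g ^ 2 + h ^ 2 = r ∧ (r : ℤ) ∣ g - I * h := by
  induction r using Nat.strong_induction_on generalizing I with
  | _ r ih =>
  rcases Nat.lt_or_ge 1 r with hr1 | hr1
  swap
  · obtain rfl : r = 1 := by omega
    exact ⟨1, 0, by simp, by simp⟩
  have hrpos : (0 : ℤ) < r := by exact_mod_cast hr
  obtain ⟨J, n, hJ, hJr⟩ : ∃ J n : ℤ, I = J + r * n ∧ 4 * J ^ 2 ≤ (r : ℤ) ^ 2 := by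
    refine ⟨I.bmod r, I.bdiv r, (Int.bmod_add_bdiv I r).symm, ?_⟩
    have h1 := Int.le_bmod (x := I) hr
    have h2 := Int.bmod_le (x := I) hr
    generalize I.bmod r = J at *
    have h3 : -(r : ℤ) ≤ 2 * J := by omega
    have h4 : 2 * J ≤ r := by omega
    nlinarith
  have hJd : (r : ℤ) ∣ J ^ 2 + 1 := by
    have : J ^ 2 + 1 = I ^ 2 + 1 - r * (n * (2 * J + r * n)) := by rw [hJ]; ring
    rw [this]
    exact dvd_sub h (dvd_mul_right _ _)
  obtain ⟨k, hk⟩ := hJd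
  have hk0 : 0 < k := by
    have : 0 < (r : ℤ) * k := by rw [← hk]; positivity
    exact pos_of_mul_pos_right this hrpos.le
  have hkr : k < r := by
    have hr2 : (2 : ℤ) ≤ r := by exact_mod_cast hr1
    nlinarith
  lift k to ℕ using hk0.le
  have hk0' : (k : ℤ) ≠ 0 := hk0.ne'
  obtain ⟨g, h', hgh, w, hw⟩ := ih k (by exact_mod_cast hkr) (by exact_mod_cast hk0) J
    ⟨r, by rw [hk, mul_comm]⟩
  have hX : (J * g + h') = k * (J * w + h' * r) := by
    linear_combination J * hw + h' * hk
  refine ⟨J * w + h' * r, w, ?_, ?_⟩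
  · have : (k : ℤ) ^ 2 * ((J * w + h' * r) ^ 2 + w ^ 2) = k ^ 2 * r := by
      have h1 : (k : ℤ) ^ 2 * ((J * w + h' * r) ^ 2 + w ^ 2) =
        (J * g + h') ^ 2 + (g - J * h') ^ 2 := by rw [hX, hw]; ring
      rw [h1]
      linear_combination (J ^ 2 + 1) * hgh + k * hk
    exact mul_left_cancel₀ (pow_ne_zero 2 hk0') this
  · exact ⟨h' - n * w, by rw [hJ]; ring⟩

theorem Int.isCoprime_of_sq_add_sq_eq {r I g h : ℤ} (hr : r ≠ 0) (hI : r ∣ I ^ 2 + 1)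
    (hgh : g ^ 2 + h ^ 2 = r) (hg : r ∣ g - I * h) : IsCoprime h r := by
  obtain ⟨c, hc⟩ := hI
  obtain ⟨n, hn⟩ := hg
  obtain rfl : g = I * h + r * n := by linear_combination hn
  refine ⟨h * c + 2 * I * n, n ^ 2, mul_left_cancel₀ hr ?_⟩
  linear_combination hgh - h ^ 2 * hc

theorem Nat.Prime.exists_odd_sq_add_even_sq {p : ℕ} (hp : p.Prime) (hp4 : p % 4 = 1) :
    ∃ a b : ℤ, a ^ 2 + b ^ 2 = p ∧ Odd a ∧ Even b := by
  have := Fact.mk hp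
  obtain ⟨a, b, hab⟩ := Nat.Prime.sq_add_sq (p := p) (by omega)
  have hodd : Odd (a ^ 2 + b ^ 2) := by rw [hab]; exact Nat.odd_iff.2 (by omega)
  rcases Nat.even_or_odd b with hb | hb
  · refine ⟨a, b, by exact_mod_cast hab, ?_, by exact_mod_cast hb⟩
    have : Odd a := by
      by_contra ha
      simp [hb, Nat.not_odd_iff_even.1 ha, ← Nat.not_even_iff_odd, parity_simps] at hodd
    exact_mod_cast this
  · refine ⟨b, a, by rw [add_comm]; exact_mod_cast hab, by exact_mod_cast hb, ?_⟩
    have : Even a := by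
      by_contra ha
      rw [← Nat.not_even_iff_odd] at hodd hb
      simp [hb, ha, parity_simps] at hodd
    exact_mod_cast this

theorem Nat.Prime.not_dvd_of_sq_add_sq_eq {p : ℕ} (hp : p.Prime) {a b : ℤ}
    (h : a ^ 2 + b ^ 2 = p) : ¬ (p : ℤ) ∣ a := by
  rintro ha
  have hp' : _root_.Prime (p : ℤ) := Nat.prime_iff_prime_int.1 hp
  have hb : (p : ℤ) ∣ b := by
    refine hp'.dvd_of_dvd_pow (n := 2) ?_
    have : b ^ 2 = p - a ^ 2 := by linarith
    rw [this]
    exact _root_.dvd_sub dvd_rfl (dvd_pow ha two_ne_zero)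
  have h2 : (p : ℤ) ^ 2 ∣ p := by
    nth_rw 2 [← h]
    exact _root_.dvd_add (_root_.pow_dvd_pow_of_dvd ha 2) (_root_.pow_dvd_pow_of_dvd hb 2)
  have h3 := Int.le_of_dvd (by exact_mod_cast hp.pos) h2
  have h4 : (2 : ℤ) ≤ p := by exact_mod_cast hp.two_le
  nlinarith

/-- Powers of a Gaussian prime above `p` eventually become real modulo `m`. -/
theorem exists_sq_add_sq_eq_pow_dvd {p m : ℕ} (hp : p.Prime) (hp4 : p % 4 = 1)
    (hm1 : 1 < m) (hmodd : Odd m) (hcop : p.Coprime m) {i : ZMod m} (hi : i ^ 2 = -1) :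
    ∃ (e : ℕ) (x y : ℤ), x ^ 2 + y ^ 2 = p ^ e ∧ Odd x ∧ Even y ∧ y ≠ 0 ∧ (m : ℤ) ∣ y := by
  obtain ⟨a, b, hab, ha, hb⟩ := hp.exists_odd_sq_add_even_sq hp4
  have hpow : ∀ n : ℕ, ∃ x y : ℤ, x ^ 2 + y ^ 2 = p ^ (n + 1) ∧ Odd x ∧ Even y ∧
      (p : ℤ) ∣ x - (2 * a) ^ n * a ∧ (p : ℤ) ∣ y - (2 * a) ^ n * b ∧
      (x : ZMod m) + i * y = (a + i * b) ^ (n + 1) ∧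
      (x : ZMod m) - i * y = (a - i * b) ^ (n + 1) := by
    intro n
    induction n with
    | zero => exact ⟨a, b, by simpa using hab, ha, hb, by simp, by simp, by simp, by simp⟩
    | succ n ih =>
      obtain ⟨x, y, h1, h2, h3, ⟨c, h4⟩, ⟨d, h5⟩, h6, h7⟩ := ih
      refine ⟨a * x - b * y, a * y + b * x, ?_, ?_, ?_, ?_, ?_, ?_, ?_⟩
      · rw [pow_succ _ (n + 1), ← h1, ← hab]; ring
      · exact (ha.mul h2).sub_even (hb.mul_right _)
      · exact (h3.mul_left _).add (hb.mul_right _)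
      · exact ⟨a * c - b * d - (2 * a) ^ n, by
          linear_combination a * h4 - b * h5 - (2 * a) ^ n * hab⟩
      · exact ⟨a * d + b * c, by linear_combination a * h5 + b * h4⟩
      · rw [pow_succ _ (n + 1), ← h6]
        push_cast
        linear_combination -(b * y : ZMod m) * hi
      · rw [pow_succ _ (n + 1), ← h7]
        push_cast
        linear_combination -(b * y : ZMod m) * hi
  have : NeZero m := ⟨by omega⟩
  have hpu : IsUnit (p : ZMod m) := (ZMod.isUnit_iff_coprime p m).2 hcop
  have hprod : ((a : ZMod m) + i * b) * (a - i * b) = p := by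
    have : ((a ^ 2 + b ^ 2 : ℤ) : ZMod m) = ((p : ℤ) : ZMod m) := by rw [hab]
    push_cast at this
    linear_combination this - (b : ZMod m) ^ 2 * hi
  have hu := isUnit_of_mul_isUnit_left (hprod ▸ hpu)
  have hv := isUnit_of_mul_isUnit_right (hprod ▸ hpu)
  have hone : ∀ {z : ZMod m}, IsUnit z → z ^ (m.totient - 1 + 1) = 1 := by
    rintro _ ⟨z, rfl⟩
    rw [Nat.sub_add_cancel (Nat.totient_pos.2 (by omega)), ← Units.val_pow_eq_pow_val,
      ZMod.pow_totient, Units.val_one]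
  obtain ⟨x, y, h1, h2, h3, -, h5, h6, h7⟩ := hpow (m.totient - 1)
  rw [hone hu] at h6
  rw [hone hv] at h7
  refine ⟨_, x, y, h1, h2, h3, ?_, ?_⟩
  · rintro rfl
    have hp' : Prime (p : ℤ) := Nat.prime_iff_prime_int.1 hp
    rw [zero_sub, dvd_neg] at h5
    have hpa : ¬ (p : ℤ) ∣ a := hp.not_dvd_of_sq_add_sq_eq hab
    have hpb : ¬ (p : ℤ) ∣ b := hp.not_dvd_of_sq_add_sq_eq (by rw [add_comm]; exact hab)
    rcases hp'.dvd_or_dvd h5 with h | h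
    · rcases hp'.dvd_or_dvd (hp'.dvd_of_dvd_pow h) with h | h
      · have : p ∣ 2 := by exact_mod_cast h
        have := Nat.le_of_dvd (by simp) this
        have := hp.two_le
        omega
      · exact hpa h
    · exact hpb h
  · rw [← ZMod.intCast_zmod_eq_zero_iff_dvd]
    have h2u : IsUnit (2 : ZMod m) := by
      exact_mod_cast (ZMod.isUnit_iff_coprime 2 m).2 (Nat.coprime_two_left.2 hmodd)
    have : (2 : ZMod m) * y = 0 := by linear_combination -i * (h6 - h7) + 2 * y * hi
    exact (h2u.mul_right_eq_zero).1 this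

/-- A representation of a power of `p` giving a unipotent matrix modulo `m`. -/
theorem exists_sq_add_sq_add_sq_eq_pow {p m : ℕ} (hp : p.Prime) (hp4 : p % 4 = 1)
    (hm1 : 1 < m) (hmodd : Odd m) (hcop : p.Coprime m) {i : ZMod m} (hi : i ^ 2 = -1) :
    ∃ (e : ℕ) (x b d : ℤ), x ^ 2 + b ^ 2 + d ^ 2 = p ^ e ∧ Odd x ∧ Even b ∧ Even d ∧
      IsUnit (b : ZMod m) ∧ i * (d : ZMod m) = b := by
  have : NeZero m := ⟨by omega⟩
  obtain ⟨e, x, y, hxy, hx, hy, hy0, hmy⟩ := exists_sq_add_sq_eq_pow_dvd hp hp4 hm1 hmodd hcop hi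
  obtain ⟨r, t, K, hrt, hrm, htm⟩ := Nat.exists_eq_mul_dvd_pow_coprime m (Int.natAbs_ne_zero.2 hy0)
  have hr0 : r ≠ 0 := by
    rintro rfl
    rw [zero_mul] at hrt
    exact Int.natAbs_ne_zero.2 hy0 hrt
  have hmr : m ∣ r := by
    have : m ∣ r * t := hrt ▸ Int.natCast_dvd.1 hmy
    exact htm.symm.dvd_of_dvd_mul_right this
  have hrodd : Odd r := Odd.of_dvd_nat (hmodd.pow) hrm
  have hteven : Even t := by
    have : Even (r * t) := hrt ▸ Int.natAbs_even.2 hy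
    exact (Nat.even_mul.1 this).resolve_left (Nat.not_even_iff_odd.2 hrodd)
  obtain ⟨I, hI, hIi⟩ := Int.exists_pow_dvd_sq_add_one (m := m) (I₀ := (i.val : ℤ))
    (by exact_mod_cast hmodd)
    (by rw [← ZMod.intCast_zmod_eq_zero_iff_dvd]; push_cast; rw [ZMod.natCast_zmod_val, hi]; ring) K
  have hIi' : (I : ZMod m) = i := by
    rw [← ZMod.intCast_zmod_eq_zero_iff_dvd] at hIi
    push_cast at hIi
    rw [ZMod.natCast_zmod_val] at hIi
    linear_combination hIi
  have hrI : (r : ℤ) ∣ I ^ 2 + 1 := by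
    refine dvd_trans ?_ hI
    exact_mod_cast hrm.trans (pow_dvd_pow m (Nat.le_succ K))
  obtain ⟨g, h, hgh, hg⟩ :=
    Int.exists_sq_add_sq_eq_of_dvd_sq_add_one r (Nat.pos_of_ne_zero hr0) I hrI
  have hhr : IsCoprime h (r : ℤ) :=
    Int.isCoprime_of_sq_add_sq_eq (by exact_mod_cast hr0) hrI hgh hg
  have hhu : IsUnit (h : ZMod m) := by
    obtain ⟨u, v, huv⟩ := hhr
    have hr : ((r : ℤ) : ZMod m) = 0 := by
      rw [ZMod.intCast_zmod_eq_zero_iff_dvd]; exact_mod_cast hmr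
    have := congrArg (Int.cast : ℤ → ZMod m) huv
    rw [Int.cast_add, Int.cast_mul, Int.cast_mul, hr, mul_zero, add_zero, Int.cast_one] at this
    exact IsUnit.of_mul_eq_one _ (by rw [mul_comm]; exact this)
  have hgi : (g : ZMod m) = i * h := by
    have : (m : ℤ) ∣ g - I * h := dvd_trans (by exact_mod_cast hmr) hg
    rw [← ZMod.intCast_zmod_eq_zero_iff_dvd] at this
    push_cast at this
    rw [hIi'] at this
    linear_combination this
  have hte : Even (t : ℤ) := by exact_mod_cast hteven
  refine ⟨e, x, t * (g ^ 2 - h ^ 2), t * (2 * g * h), ?_, hx, hte.mul_right _, hte.mul_right _,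
    ?_, ?_⟩
  · have hy2 : y ^ 2 = (r * t : ℤ) ^ 2 := by
      rw [← Int.natAbs_sq, hrt]; push_cast; ring
    rw [← hxy, hy2, ← hgh]
    ring
  · have h2u : IsUnit (2 : ZMod m) := by
      exact_mod_cast (ZMod.isUnit_iff_coprime 2 m).2 (Nat.coprime_two_left.2 hmodd)
    have htu : IsUnit (t : ZMod m) := (ZMod.isUnit_iff_coprime t m).2 htm
    have : ((t * (g ^ 2 - h ^ 2) : ℤ) : ZMod m) = -(t * 2 * (h * h)) := by
      push_cast
      rw [hgi]
      linear_combination t * (h : ZMod m) ^ 2 * hi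
    rw [this]
    exact ((htu.mul h2u).mul (hhu.mul hhu)).neg
  · push_cast
    rw [hgi]
    linear_combination (t * h ^ 2 : ZMod m) * hi

namespace Matrix.SpecialLinearGroup

variable {R : Type*} [CommRing R]

/-- The upper unipotent matrix with parameter `t`. -/
def upper (t : R) : SpecialLinearGroup (Fin 2) R := ⟨!![1, t; 0, 1], by simp⟩

/-- The lower unipotent matrix with parameter `t`. -/
def lower (t : R) : SpecialLinearGroup (Fin 2) R := ⟨!![1, 0; t, 1], by simp⟩

@[simp] theorem coe_upper (t : R) : (upper t : Matrix (Fin 2) (Fin 2) R) = !![1, t; 0, 1] := rfl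

@[simp] theorem coe_lower (t : R) : (lower t : Matrix (Fin 2) (Fin 2) R) = !![1, 0; t, 1] := rfl

theorem upper_nsmul (n : ℕ) (t : R) : upper (n * t) = upper t ^ n := by
  induction n with
  | zero => ext i j; fin_cases i <;> fin_cases j <;> simp
  | succ n ih =>
    rw [pow_succ, ← ih]
    ext i j
    fin_cases i <;> fin_cases j <;> simp [Matrix.mul_apply, Fin.sum_univ_two]
    ring

theorem lower_nsmul (n : ℕ) (t : R) : lower (n * t) = lower t ^ n := by
  induction n with
  | zero => ext i j; fin_cases i <;> fin_cases j <;> simp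
  | succ n ih =>
    rw [pow_succ, ← ih]
    ext i j
    fin_cases i <;> fin_cases j <;> simp [Matrix.mul_apply, Fin.sum_univ_two]
    ring

theorem mem_of_upper_mem_of_lower_mem_of_isUnit {H : Subgroup (SpecialLinearGroup (Fin 2) R)}
    (hU : ∀ t, upper t ∈ H) (hL : ∀ t, lower t ∈ H) {A : SpecialLinearGroup (Fin 2) R}
    (hA : IsUnit (A.1 0 0)) : A ∈ H := by
  obtain ⟨u, hu⟩ := hA
  have hdet : A.1 0 0 * A.1 1 1 - A.1 0 1 * A.1 1 0 = 1 := by rw [← det_fin_two, A.2]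
  have huu : A.1 0 0 * ((u⁻¹ : Rˣ) : R) = 1 := by rw [← hu, Units.mul_inv]
  have key : A = lower (-((1 - A.1 1 0) * ((u⁻¹ : Rˣ) : R))) * upper (-(1 - A.1 0 0)) * lower 1 *
      upper (A.1 0 1 + (1 - A.1 0 0) *
        (A.1 1 1 + (1 - A.1 1 0) * ((u⁻¹ : Rˣ) : R) * A.1 0 1)) := by
    generalize ((u⁻¹ : Rˣ) : R) = v at *
    ext i j
    fin_cases i <;> fin_cases j <;>
      simp [Matrix.mul_apply, Fin.sum_univ_two]
    · linear_combination -(1 - A.1 0 0) * hdet -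
        (1 - A.1 0 0) * (1 - A.1 1 0) * A.1 0 1 * huu
    · linear_combination (1 - A.1 1 0) * huu
    · linear_combination (1 + (1 - A.1 1 0) * v * (1 - A.1 0 0)) * hdet +
        (1 + (1 - A.1 1 0) * v * (1 - A.1 0 0)) * (1 - A.1 1 0) * A.1 0 1 * huu
  rw [key]
  exact H.mul_mem (H.mul_mem (H.mul_mem (hL _) (hU _)) (hL _)) (hU _)

theorem eq_top_of_upper_mem_of_lower_mem {m : ℕ} (hm : m ≠ 0)
    {H : Subgroup (SpecialLinearGroup (Fin 2) (ZMod m))}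
    (hU : ∀ t, upper t ∈ H) (hL : ∀ t, lower t ∈ H) : H = ⊤ := by
  rw [eq_top_iff]
  intro A _
  have : NeZero m := ⟨hm⟩
  have hdet : A.1 0 0 * A.1 1 1 - A.1 0 1 * A.1 1 0 = 1 := by rw [← det_fin_two, A.2]
  obtain ⟨r, t, K, hrt, hr, ht⟩ := Nat.exists_eq_mul_dvd_pow_coprime (A.1 0 0).val hm
  have hunit : IsUnit (A.1 0 0 + t * A.1 1 0) := by
    have hcast : A.1 0 0 + t * A.1 1 0 =
        (((A.1 0 0).val + t * (A.1 1 0).val : ℕ) : ZMod m) := by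
      push_cast
      rw [ZMod.natCast_zmod_val, ZMod.natCast_zmod_val]
    rw [hcast, ZMod.isUnit_iff_coprime]
    refine Nat.coprime_of_dvd fun l hl hl1 hlm ↦ ?_
    rw [hrt] at hlm
    by_cases hlt : l ∣ t
    · have hla : l ∣ (A.1 0 0).val := (Nat.dvd_add_left (hlt.mul_right _)).1 hl1
      exact hl.one_lt.ne' (Nat.dvd_one.1 (ht ▸ Nat.dvd_gcd hlt hla))
    · have hlr : l ∣ r := (hl.dvd_mul.1 hlm).resolve_right hlt
      have hla : l ∣ (A.1 0 0).val := hl.dvd_of_dvd_pow (hlr.trans hr)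
      have hlc : l ∣ (A.1 1 0).val :=
        (hl.dvd_mul.1 ((Nat.dvd_add_right hla).1 hl1)).resolve_left hlt
      have hlm' : l ∣ m := hrt ▸ hlm
      have : Fact (1 < l) := ⟨hl.one_lt⟩
      have h1 := congrArg (ZMod.castHom hlm' (ZMod l)) hdet
      have hz : ∀ z : ZMod m, l ∣ z.val → ZMod.castHom hlm' (ZMod l) z = 0 := by
        intro z hz
        rw [← ZMod.natCast_zmod_val z, map_natCast]
        exact (ZMod.natCast_eq_zero_iff _ _).2 hz
      rw [map_sub, map_mul, map_mul, hz _ hla, hz _ hlc, map_one] at h1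
      simp at h1
  have hmem : upper (t : ZMod m) * A ∈ H := by
    refine mem_of_upper_mem_of_lower_mem_of_isUnit hU hL ?_
    have : (upper (t : ZMod m) * A).1 0 0 = A.1 0 0 + t * A.1 1 0 := by
      simp [Matrix.mul_apply, Fin.sum_univ_two]
    rwa [this]
  exact (H.mul_mem_cancel_left (hU _)).1 hmem

theorem mk_center_eq_mk_center_iff {A B : SpecialLinearGroup (Fin 2) R} :
    (QuotientGroup.mk A : SpecialLinearGroup (Fin 2) R ⧸
        Subgroup.center (SpecialLinearGroup (Fin 2) R)) = QuotientGroup.mk B ↔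
      ∃ r : R, A.1 = r • B.1 := by
  rw [eq_comm, QuotientGroup.eq, mem_center_iff]
  constructor
  · rintro ⟨r, -, hr⟩
    refine ⟨r, ?_⟩
    have : A = B * (B⁻¹ * A) := by group
    rw [congrArg Subtype.val this, coe_mul, ← hr]
    simp [Matrix.smul_eq_mul_diagonal, Matrix.scalar_apply]
  · rintro ⟨r, hr⟩
    have hr2 : r ^ 2 = 1 := by
      have := congrArg Matrix.det hr
      simpa [Matrix.det_smul] using this.symm
    refine ⟨r, by simpa using hr2, ?_⟩
    rw [coe_mul, hr, Matrix.mul_smul, ← coe_mul, inv_mul_cancel]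
    simp [Matrix.smul_one_eq_diagonal, Matrix.scalar_apply]

end Matrix.SpecialLinearGroup

open Quaternion Matrix.SpecialLinearGroup

/-- The matrix of an integral quaternion, for a square root `i` of `-1`. -/
def lpsMatrix {R : Type*} [CommRing R] (i : R) (a : ℍ[ℤ]) : Matrix (Fin 2) (Fin 2) R :=
  !![(a.re : R) + i * (a.imI : R), (a.imJ : R) + i * (a.imK : R);
    -(a.imJ : R) + i * (a.imK : R), (a.re : R) - i * (a.imI : R)]

section lpsMatrix

variable {R : Type*} [CommRing R] {i : R}

theorem lpsMatrix_mul (hi : i ^ 2 = -1) (a b : ℍ[ℤ]) :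
    lpsMatrix i (a * b) = lpsMatrix i a * lpsMatrix i b := by
  ext j k
  fin_cases j <;> fin_cases k <;>
    simp [lpsMatrix, Matrix.mul_apply, Fin.sum_univ_two, re_mul, imI_mul, imJ_mul, imK_mul]
  · linear_combination (-(a.imI * b.imI) - a.imK * b.imK + 0 : R) * hi
  · linear_combination (-(a.imI * b.imK) + a.imK * b.imI : R) * hi
  · linear_combination (-(a.imK * b.imI) + a.imI * b.imK : R) * hi
  · linear_combination (-(a.imK * b.imK) - a.imI * b.imI : R) * hi

theorem det_lpsMatrix (hi : i ^ 2 = -1) (a : ℍ[ℤ]) :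
    (lpsMatrix i a).det = (normSq a : ℤ) := by
  rw [lpsMatrix, det_fin_two_of, normSq_def']
  push_cast
  linear_combination (-(a.imI ^ 2) - a.imK ^ 2 : R) * hi

theorem lpsMatrix_natCast_mul (n : ℕ) (a : ℍ[ℤ]) :
    lpsMatrix i ((n : ℍ[ℤ]) * a) = (n : R) • lpsMatrix i a := by
  ext j k
  fin_cases j <;> fin_cases k <;> simp [lpsMatrix, re_mul, imI_mul, imJ_mul, imK_mul] <;> ring

theorem lpsMatrix_one : lpsMatrix i 1 = 1 := by
  ext j k
  fin_cases j <;> fin_cases k <;> simp [lpsMatrix]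

theorem lpsMatrix_star (a : ℍ[ℤ]) : lpsMatrix i (star a) = (lpsMatrix i a).adjugate := by
  ext j k
  fin_cases j <;> fin_cases k <;> simp [lpsMatrix, Matrix.adjugate_fin_two] <;> ring

end lpsMatrix

/-- The class `g` is represented by the normalized matrix of an integral quaternion
congruent to `1` modulo `2` and of norm `p ^ n`. -/
def IsLpsClass (p : ℕ) {m : ℕ} (i s : ZMod m) (n : ℕ)
    (g : SpecialLinearGroup (Fin 2) (ZMod m) ⧸
      Subgroup.center (SpecialLinearGroup (Fin 2) (ZMod m))) : Prop :=
  ∃ (a : ℍ[ℤ]) (A : SpecialLinearGroup (Fin 2) (ZMod m)), IsOneModTwo a ∧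
    normSq a = (p : ℤ) ^ n ∧ A.1 = s⁻¹ ^ n • lpsMatrix i a ∧ g = QuotientGroup.mk A

/-- The class `g` is represented by the normalized matrix of an integral quaternion
congruent to `1` modulo `2`, of norm `p` and with positive real part. -/
def IsLpsGenerator (p : ℕ) {m : ℕ} (i s : ZMod m)
    (g : SpecialLinearGroup (Fin 2) (ZMod m) ⧸
      Subgroup.center (SpecialLinearGroup (Fin 2) (ZMod m))) : Prop :=
  ∃ (a : ℍ[ℤ]) (A : SpecialLinearGroup (Fin 2) (ZMod m)), IsOneModTwo a ∧ 0 < a.re ∧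
    normSq a = (p : ℤ) ∧ A.1 = s⁻¹ • lpsMatrix i a ∧ g = QuotientGroup.mk A

section IsLpsClass

variable {p m : ℕ} {i s : ZMod m}

theorem IsLpsGenerator.isLpsClass {g} (hg : IsLpsGenerator p i s g) : IsLpsClass p i s 1 g := by
  obtain ⟨a, A, ha, -, hn, hA, rfl⟩ := hg
  exact ⟨a, A, ha, by simpa using hn, by simpa using hA, rfl⟩

theorem IsLpsClass.one : IsLpsClass p i s 0 1 :=
  ⟨1, 1, .one, by simp, by simp [lpsMatrix_one], rfl⟩

theorem IsLpsClass.mul (hi : i ^ 2 = -1) {n k : ℕ} {g h} (hg : IsLpsClass p i s n g)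
    (hh : IsLpsClass p i s k h) : IsLpsClass p i s (n + k) (g * h) := by
  obtain ⟨a, A, ha, hna, hA, rfl⟩ := hg
  obtain ⟨b, B, hb, hnb, hB, rfl⟩ := hh
  refine ⟨a * b, A * B, ha.mul hb, by rw [map_mul, hna, hnb, pow_add], ?_, rfl⟩
  rw [Matrix.SpecialLinearGroup.coe_mul, hA, hB, lpsMatrix_mul hi, smul_mul_smul_comm, pow_add]

theorem IsLpsClass.inv {n : ℕ} {g} (hg : IsLpsClass p i s n g) :
    IsLpsClass p i s n g⁻¹ := by
  obtain ⟨a, A, ha, hna, hA, rfl⟩ := hg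
  refine ⟨star a, A⁻¹, ha.star, by rw [normSq_star, hna], ?_, rfl⟩
  rw [Matrix.SpecialLinearGroup.coe_inv, hA, lpsMatrix_star, adjugate_smul]
  simp

theorem exists_coe_eq_smul_lpsMatrix (hi : i ^ 2 = -1) (hs : s⁻¹ ^ 2 * p = 1) {n : ℕ} {a : ℍ[ℤ]}
    (ha : normSq a = (p : ℤ) ^ n) :
    ∃ A : SpecialLinearGroup (Fin 2) (ZMod m), A.1 = s⁻¹ ^ n • lpsMatrix i a := by
  refine ⟨⟨s⁻¹ ^ n • lpsMatrix i a, ?_⟩, rfl⟩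
  rw [det_smul, det_lpsMatrix hi, ha, Fintype.card_fin, ← pow_mul, mul_comm n, pow_mul]
  push_cast
  rw [← mul_pow, hs, one_pow]

/-- Every class coming from a quaternion of norm `p ^ n` is a product of generators. -/
theorem IsLpsClass.mem_subgroup (hp : p.Prime) (hp4 : p % 4 = 1) (hi : i ^ 2 = -1)
    (hs : s⁻¹ ^ 2 * p = 1) {H : Subgroup (SpecialLinearGroup (Fin 2) (ZMod m) ⧸
      Subgroup.center (SpecialLinearGroup (Fin 2) (ZMod m)))}
    (hH : ∀ g, IsLpsGenerator p i s g → g ∈ H) {n : ℕ} {g} (hg : IsLpsClass p i s n g) :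
    g ∈ H := by
  induction n using Nat.strong_induction_on generalizing g with
  | _ n ih =>
    obtain ⟨a, A, ha, hn, hA, rfl⟩ := hg
    have hp0 : (p : ℤ) ≠ 0 := by exact_mod_cast hp.ne_zero
    rcases n with _ | n
    · rw [normSq_def', pow_zero] at hn
      have hre : a.re ≠ 0 := fun h ↦ by simpa [h] using ha.1
      have h1 : 0 < a.re ^ 2 := by positivity
      have hI : a.imI = 0 := by
        refine pow_eq_zero_iff two_ne_zero |>.1 ?_
        nlinarith [sq_nonneg a.imI, sq_nonneg a.imJ, sq_nonneg a.imK]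
      have hJ : a.imJ = 0 := by
        refine pow_eq_zero_iff two_ne_zero |>.1 ?_
        nlinarith [sq_nonneg a.imI, sq_nonneg a.imJ, sq_nonneg a.imK]
      have hK : a.imK = 0 := by
        refine pow_eq_zero_iff two_ne_zero |>.1 ?_
        nlinarith [sq_nonneg a.imI, sq_nonneg a.imJ, sq_nonneg a.imK]
      have : (QuotientGroup.mk A : SpecialLinearGroup (Fin 2) (ZMod m) ⧸
          Subgroup.center (SpecialLinearGroup (Fin 2) (ZMod m))) =
          QuotientGroup.mk (1 : SpecialLinearGroup (Fin 2) (ZMod m)) := by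
        refine mk_center_eq_mk_center_iff.2 ⟨a.re, ?_⟩
        rw [hA]
        ext j k
        fin_cases j <;> fin_cases k <;> simp [lpsMatrix, hI, hJ, hK]
      rw [this]
      exact H.one_mem
    · by_cases hpa : (p : ℍ[ℤ]) ∣ a
      · obtain ⟨b, rfl⟩ := hpa
        rw [normSq_natCast_mul] at hn
        rcases n with _ | n
        · exfalso
          have h1 : (p : ℤ) * normSq b = 1 := by
            refine mul_left_cancel₀ hp0 ?_
            linear_combination hn
          have h2 : (p : ℤ) ∣ 1 := ⟨_, h1.symm⟩
          exact hp.one_lt.ne' (Nat.dvd_one.1 (by exact_mod_cast h2))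
        · refine ih n (by omega) ⟨b, A, ha.of_natCast_mul (Nat.odd_iff.2 (by omega)), ?_, ?_, rfl⟩
          · refine mul_left_cancel₀ (pow_ne_zero 2 hp0) ?_
            rw [hn]; ring
          · rw [hA, lpsMatrix_natCast_mul, smul_smul]
            congr 1
            linear_combination s⁻¹ ^ n * hs
      · obtain ⟨b, c, rfl, hb, hc, hc0, hcp⟩ :=
          exists_right_factor hp hp4 ha (hn ▸ dvd_pow_self _ n.succ_ne_zero) hpa
        have hbn : normSq b = (p : ℤ) ^ n := by
          refine mul_right_cancel₀ hp0 ?_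
          rw [← pow_succ, ← hn, map_mul, hcp]
        obtain ⟨B, hB⟩ := exists_coe_eq_smul_lpsMatrix hi hs hbn
        obtain ⟨C, hC⟩ := exists_coe_eq_smul_lpsMatrix (n := 1) hi hs (by simpa using hcp)
        rw [pow_one] at hC
        have hABC : A = B * C := by
          refine Subtype.ext ?_
          rw [Matrix.SpecialLinearGroup.coe_mul, hA, hB, hC, lpsMatrix_mul hi, smul_mul_smul_comm,
            pow_succ]
        rw [hABC, QuotientGroup.mk_mul]
        exact H.mul_mem (ih n n.lt_succ_self ⟨b, B, hb, hbn, hB, rfl⟩)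
          (hH _ ⟨c, C, hc, hc0, hcp, hC, rfl⟩)

/-- The generators of the graph generate the whole group (strong approximation). -/
theorem eq_top_of_isLpsGenerator_mem (hp : p.Prime) (hp4 : p % 4 = 1) (hm1 : 1 < m)
    (hmodd : Odd m) (hcop : p.Coprime m) (hi : i ^ 2 = -1) (hs : s⁻¹ ^ 2 * p = 1)
    {H : Subgroup (SpecialLinearGroup (Fin 2) (ZMod m) ⧸
      Subgroup.center (SpecialLinearGroup (Fin 2) (ZMod m)))}
    (hH : ∀ g, IsLpsGenerator p i s g → g ∈ H) : H = ⊤ := by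
  have : NeZero m := ⟨by omega⟩
  obtain ⟨e, x, b, d, hxbd, hx, hb, hd, hbu, hid⟩ :=
    exists_sq_add_sq_add_sq_eq_pow hp hp4 hm1 hmodd hcop hi
  have h2u : IsUnit (2 : ZMod m) := by
    exact_mod_cast (ZMod.isUnit_iff_coprime 2 m).2 (Nat.coprime_two_left.2 hmodd)
  have hpu : IsUnit (p : ZMod m) := (ZMod.isUnit_iff_coprime p m).2 hcop
  have hx2 : (x : ZMod m) ^ 2 = p ^ e := by
    have := congrArg (Int.cast : ℤ → ZMod m) hxbd
    push_cast at this
    linear_combination this + (b + i * d) * hid - (d : ZMod m) ^ 2 * hi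
  have hxu : IsUnit (x : ZMod m) := (isUnit_pow_iff two_ne_zero).1 (hx2 ▸ hpu.pow e)
  obtain ⟨v, hv⟩ := hxu.exists_right_inv
  have hvu : IsUnit v := IsUnit.of_mul_eq_one _ (by rw [mul_comm]; exact hv)
  obtain ⟨w, hw⟩ := ((h2u.mul hbu).mul hvu).exists_left_inv
  have hmem : ∀ B : SpecialLinearGroup (Fin 2) (ZMod m),
      (∃ a : ℍ[ℤ], IsOneModTwo a ∧ normSq a = (p : ℤ) ^ e ∧
        lpsMatrix i a = (x : ZMod m) • B.1) → QuotientGroup.mk B ∈ H := by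
    rintro B ⟨a, ha, hn, haB⟩
    obtain ⟨A, hA⟩ := exists_coe_eq_smul_lpsMatrix hi hs hn
    have : (QuotientGroup.mk A : SpecialLinearGroup (Fin 2) (ZMod m) ⧸
        Subgroup.center (SpecialLinearGroup (Fin 2) (ZMod m))) = QuotientGroup.mk B :=
      mk_center_eq_mk_center_iff.2 ⟨s⁻¹ ^ e * x, by rw [hA, haB, smul_smul]⟩
    rw [← this]
    exact IsLpsClass.mem_subgroup hp hp4 hi hs hH ⟨a, A, ha, hn, hA, rfl⟩
  have hmul : ∀ t : ZMod m, t = ((t * w).val : ℕ) * (2 * b * v) := by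
    intro t
    rw [ZMod.natCast_zmod_val]
    linear_combination -t * hw
  have htop : H.comap (QuotientGroup.mk' _) = ⊤ := by
    refine eq_top_of_upper_mem_of_lower_mem (by omega) (fun t ↦ ?_) (fun t ↦ ?_)
    · rw [hmul t, upper_nsmul]
      refine Subgroup.pow_mem _ (hmem _ ⟨ofCoords x 0 b d, ⟨hx, .zero, hb, hd⟩, ?_, ?_⟩) _
      · rw [normSq_def', ← hxbd]; simp
      · ext j k
        fin_cases j <;> fin_cases k <;> simp [lpsMatrix]
        · linear_combination hid - 2 * b * hv
        · linear_combination hid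
    · rw [hmul t, lower_nsmul]
      refine Subgroup.pow_mem _ (hmem _ ⟨ofCoords x 0 (-b) d, ⟨hx, .zero, hb.neg, hd⟩, ?_, ?_⟩) _
      · rw [normSq_def', ← hxbd]; simp
      · ext j k
        fin_cases j <;> fin_cases k <;> simp [lpsMatrix]
        · linear_combination hid
        · linear_combination hid - 2 * b * hv
  rw [eq_top_iff]
  intro g _
  obtain ⟨A, rfl⟩ := QuotientGroup.mk_surjective g
  exact (htop ▸ Subgroup.mem_top A : A ∈ H.comap (QuotientGroup.mk' _))

variable {X : SimpleGraph (SpecialLinearGroup (Fin 2) (ZMod m) ⧸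
  Subgroup.center (SpecialLinearGroup (Fin 2) (ZMod m)))}

theorem lpsGraph_connected (hp : p.Prime) (hp4 : p % 4 = 1) (hm1 : 1 < m)
    (hmodd : Odd m) (hcop : p.Coprime m) (hi : i ^ 2 = -1) (hs : s⁻¹ ^ 2 * p = 1)
    (hX : ∀ x y, X.Adj x y ↔
      x ≠ y ∧ (IsLpsGenerator p i s (x⁻¹ * y) ∨ IsLpsGenerator p i s (y⁻¹ * x))) :
    X.Connected := by
  let H : Subgroup (SpecialLinearGroup (Fin 2) (ZMod m) ⧸
      Subgroup.center (SpecialLinearGroup (Fin 2) (ZMod m))) :=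
    { carrier := {g | ∀ x, X.Reachable x (x * g)}
      one_mem' := fun x ↦ by rw [mul_one]
      mul_mem' := fun {g h} hg hh x ↦ (hg x).trans (by rw [← mul_assoc]; exact hh _)
      inv_mem' := fun {g} hg x ↦ by simpa using (hg (x * g⁻¹)).symm }
  have htop : H = ⊤ := by
    refine eq_top_of_isLpsGenerator_mem hp hp4 hm1 hmodd hcop hi hs fun g hg x ↦ ?_
    by_cases hxg : x = x * g
    · rw [← hxg]
    · exact ((hX _ _).2 ⟨hxg, .inl (by simpa using hg)⟩).reachable
  refine ⟨fun x y ↦ ?_⟩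
  have : x⁻¹ * y ∈ H := htop ▸ Subgroup.mem_top _
  simpa using this x

theorem isLpsClass_of_walk (hi : i ^ 2 = -1)
    (hX : ∀ x y, X.Adj x y ↔
      x ≠ y ∧ (IsLpsGenerator p i s (x⁻¹ * y) ∨ IsLpsGenerator p i s (y⁻¹ * x)))
    {x y} (w : X.Walk x y) : IsLpsClass p i s w.length (x⁻¹ * y) := by
  induction w with
  | nil => simpa using IsLpsClass.one
  | @cons x y z h w ih =>
    have hxy : IsLpsClass p i s 1 (x⁻¹ * y) := by
      rcases ((hX x y).1 h).2 with h | h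
      · exact h.isLpsClass
      · simpa using h.isLpsClass.inv
    rw [SimpleGraph.Walk.length_cons, add_comm]
    simpa [mul_assoc] using hxy.mul hi ih

theorem IsLpsClass.exists_eq_smul (hi : i ^ 2 = -1) (hs : s⁻¹ ^ 2 * p = 1) {n : ℕ}
    {B : SpecialLinearGroup (Fin 2) (ZMod m)} (h : IsLpsClass p i s n (QuotientGroup.mk B)) :
    ∃ (a : ℍ[ℤ]) (c : ZMod m), IsOneModTwo a ∧ normSq a = (p : ℤ) ^ n ∧ c ^ 2 = p ^ n ∧
      lpsMatrix i a = c • B.1 := by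
  obtain ⟨a, A, ha, hn, hA, hAB⟩ := h
  obtain ⟨r, hr⟩ := mk_center_eq_mk_center_iff.1 hAB.symm
  have hpow : (s⁻¹ * p) ^ n * s⁻¹ ^ n = 1 := by
    rw [← mul_pow, ← one_pow n, ← hs]; ring
  have haB : lpsMatrix i a = ((s⁻¹ * p) ^ n * r) • B.1 := by
    rw [← smul_smul, ← hr, hA, smul_smul, hpow, one_smul]
  refine ⟨a, _, ha, hn, ?_, haB⟩
  have := congrArg Matrix.det haB
  rw [det_lpsMatrix hi, hn, det_smul, B.2] at this
  simpa using this.symm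

theorem dvd_of_intCast_eq_mul {q : ℕ} (hqm : q ∣ m) {z : ℤ} {w : ZMod m}
    (h : (z : ZMod m) = w * q) : (q : ℤ) ∣ z := by
  rw [← ZMod.intCast_zmod_eq_zero_iff_dvd, ← map_intCast (ZMod.castHom hqm (ZMod q)), h, map_mul,
    map_natCast, ZMod.natCast_self, mul_zero]

theorem IsLpsClass.exists_odd_of_upper (hmodd : Odd m) (hcop : p.Coprime m)
    (hi : i ^ 2 = -1) (hs : s⁻¹ ^ 2 * p = 1) {q : ℕ} (hqm : q ∣ m) (hqne : q ≠ m) {n : ℕ}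
    (h : IsLpsClass p i s n (QuotientGroup.mk (upper (q : ZMod m)))) :
    ∃ x : ℤ, Odd x ∧ x ^ 2 < p ^ n ∧ (q : ℤ) ^ 2 ∣ p ^ n - x ^ 2 := by
  obtain ⟨a, c, ha, hn, hc, haB⟩ := h.exists_eq_smul hi hs
  have h2u : IsUnit (2 : ZMod m) := by
    exact_mod_cast (ZMod.isUnit_iff_coprime 2 m).2 (Nat.coprime_two_left.2 hmodd)
  obtain ⟨t, ht⟩ := h2u.exists_right_inv
  have hcu : IsUnit c :=
    (isUnit_pow_iff two_ne_zero).1 (hc ▸ ((ZMod.isUnit_iff_coprime p m).2 hcop).pow n)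
  have e00 := congrFun (congrFun haB 0) 0
  have e01 := congrFun (congrFun haB 0) 1
  have e10 := congrFun (congrFun haB 1) 0
  have e11 := congrFun (congrFun haB 1) 1
  simp [lpsMatrix] at e00 e01 e10 e11
  have hI : (a.imI : ZMod m) = 0 * q := by
    linear_combination (-i * t) * (e00 - e11) + (2 * t * a.imI) * hi - a.imI * ht
  have hJ : (a.imJ : ZMod m) = t * c * q := by
    linear_combination t * (e01 - e10) - a.imJ * ht
  have hK : (a.imK : ZMod m) = -i * t * c * q := by
    linear_combination -i * t * (e01 + e10) + (2 * t * a.imK) * hi - a.imK * ht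
  obtain ⟨x, hx⟩ := dvd_of_intCast_eq_mul hqm hI
  obtain ⟨y, hy⟩ := dvd_of_intCast_eq_mul hqm hJ
  obtain ⟨z, hz⟩ := dvd_of_intCast_eq_mul hqm hK
  rw [normSq_def'] at hn
  refine ⟨a.re, ha.1, ?_, x ^ 2 + y ^ 2 + z ^ 2, ?_⟩
  · have hJ0 : a.imJ ≠ 0 := by
      intro h0
      rw [h0, Int.cast_zero] at e01 e10
      have hq0 : c * q = 0 := by linear_combination e10 - e01
      rw [hcu.mul_right_eq_zero, ZMod.natCast_eq_zero_iff] at hq0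
      exact hqne (Nat.dvd_antisymm hqm hq0)
    have := pow_pos (abs_pos.2 hJ0) 2
    rw [sq_abs] at this
    nlinarith [sq_nonneg a.imI, sq_nonneg a.imK]
  · rw [← hn, hx, hy, hz]; ring

theorem IsLpsClass.exists_even_of_weyl (hmodd : Odd m)
    (hi : i ^ 2 = -1) (hs : s⁻¹ ^ 2 * p = 1) {q : ℕ} (hqm : q ∣ m) {n : ℕ}
    {W : SpecialLinearGroup (Fin 2) (ZMod m)} (hW : W.1 = !![0, 1; -1, 0])
    (h : IsLpsClass p i s n (QuotientGroup.mk W)) :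
    ∃ x : ℤ, Even x ∧ x ^ 2 < p ^ n ∧ (q : ℤ) ^ 2 ∣ p ^ n - x ^ 2 := by
  obtain ⟨a, c, ha, hn, hc, haB⟩ := h.exists_eq_smul hi hs
  have h2u : IsUnit (2 : ZMod m) := by
    exact_mod_cast (ZMod.isUnit_iff_coprime 2 m).2 (Nat.coprime_two_left.2 hmodd)
  obtain ⟨t, ht⟩ := h2u.exists_right_inv
  rw [hW] at haB
  have e00 := congrFun (congrFun haB 0) 0
  have e01 := congrFun (congrFun haB 0) 1
  have e10 := congrFun (congrFun haB 1) 0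
  have e11 := congrFun (congrFun haB 1) 1
  simp [lpsMatrix] at e00 e01 e10 e11
  have hR : (a.re : ZMod m) = 0 * q := by
    linear_combination t * (e00 + e11) - a.re * ht
  have hI : (a.imI : ZMod m) = 0 * q := by
    linear_combination (-i * t) * (e00 - e11) + (2 * t * a.imI) * hi - a.imI * ht
  have hK : (a.imK : ZMod m) = 0 * q := by
    linear_combination -i * t * (e01 + e10) + (2 * t * a.imK) * hi - a.imK * ht
  obtain ⟨x, hx⟩ := dvd_of_intCast_eq_mul hqm hR
  obtain ⟨y, hy⟩ := dvd_of_intCast_eq_mul hqm hI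
  obtain ⟨z, hz⟩ := dvd_of_intCast_eq_mul hqm hK
  rw [normSq_def'] at hn
  refine ⟨a.imJ, ha.2.2.1, ?_, x ^ 2 + y ^ 2 + z ^ 2, ?_⟩
  · have hR0 : a.re ≠ 0 := fun h ↦ by simpa [h] using ha.1
    have := pow_pos (abs_pos.2 hR0) 2
    rw [sq_abs] at this
    nlinarith [sq_nonneg a.imI, sq_nonneg a.imK]
  · rw [← hn, hx, hy, hz]; ring

end IsLpsClass

/-- Two essentially different square roots of `P` modulo `q ^ 2` cannot both be small. -/
theorem pow_four_le_of_sq_dvd_sub {q : ℕ} (hq : IsPrimePow q) (hqodd : Odd q) {P x y : ℤ}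
    (hP : IsCoprime (q : ℤ) P) (hx : (q : ℤ) ^ 2 ∣ P - x ^ 2) (hy : (q : ℤ) ^ 2 ∣ P - y ^ 2)
    (hxP : x ^ 2 ≤ P) (hyP : y ^ 2 ≤ P) (hxy : x ^ 2 ≠ y ^ 2) : (q : ℤ) ^ 4 ≤ 4 * P := by
  obtain ⟨l, k, hl, hk, rfl⟩ := (isPrimePow_nat_iff _).1 hq
  have hlint : Prime (l : ℤ) := Nat.prime_iff_prime_int.1 hl
  have hlq : (l : ℤ) ∣ ((l ^ k : ℕ) : ℤ) := by exact_mod_cast dvd_pow_self l hk.ne'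
  have hle : ∀ z : ℤ, z ≠ 0 → z ^ 2 ≤ 4 * P → ((l ^ k : ℕ) : ℤ) ^ 2 ∣ z →
      ((l ^ k : ℕ) : ℤ) ^ 4 ≤ 4 * P := by
    intro z hz hzP hdvd
    have h1 := Int.le_of_dvd (abs_pos.2 hz) ((dvd_abs _ _).2 hdvd)
    have h2 := pow_le_pow_left₀ (sq_nonneg _) h1 2
    rw [sq_abs] at h2
    linarith [show (((l ^ k : ℕ) : ℤ) ^ 2) ^ 2 = ((l ^ k : ℕ) : ℤ) ^ 4 by ring]
  have hcop : ∀ z : ℤ, ¬ (l : ℤ) ∣ z → IsCoprime (((l ^ k : ℕ) : ℤ) ^ 2) z := by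
    intro z hz
    push_cast
    exact ((hlint.coprime_iff_not_dvd.2 hz).pow_left).pow_left
  have hdvd : ((l ^ k : ℕ) : ℤ) ^ 2 ∣ (x + y) * (x - y) := by
    have := dvd_sub hy hx
    rwa [show P - y ^ 2 - (P - x ^ 2) = (x + y) * (x - y) by ring] at this
  by_cases hadd : (l : ℤ) ∣ x + y
  · have hsub : ¬ (l : ℤ) ∣ x - y := by
      intro hsub
      have h2x : (l : ℤ) ∣ 2 * x := by
        rw [show 2 * x = x + y + (x - y) by ring]
        exact dvd_add hadd hsub
      rcases hlint.dvd_or_dvd h2x with h | h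
      · have h' : l ∣ 2 := by exact_mod_cast h
        have := (Nat.prime_dvd_prime_iff_eq hl Nat.prime_two).1 h'
        subst this
        exact (Nat.not_odd_iff_even.2 ((even_two).pow_of_ne_zero hk.ne')) hqodd
      · have hlP : (l : ℤ) ∣ P := by
          have h1 := dvd_add ((hlq.trans (dvd_pow_self _ two_ne_zero)).trans hx)
            (dvd_pow h two_ne_zero)
          rwa [sub_add_cancel] at h1
        exact hlint.not_isUnit (hP.isUnit_of_dvd' hlq hlP)
    refine hle (x + y) (fun h ↦ hxy (by linear_combination (x - y) * h)) ?_
      ((hcop _ hsub).dvd_of_dvd_mul_right hdvd)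
    nlinarith [sq_nonneg (x - y)]
  · refine hle (x - y) (fun h ↦ hxy (by linear_combination (x + y) * h)) ?_
      ((hcop _ hadd).dvd_of_dvd_mul_left hdvd)
    nlinarith [sq_nonneg (x + y)]

theorem pow_four_le_or_of_odd_of_even {p q : ℕ} (hpodd : Odd p) (hq : IsPrimePow q)
    (hqodd : Odd q) (hpq : p.Coprime q) {k l : ℕ} {x y : ℤ} (hx : Odd x) (hy : Even y)
    (hxk : x ^ 2 < p ^ k) (hyl : y ^ 2 < p ^ l) (hxq : (q : ℤ) ^ 2 ∣ p ^ k - x ^ 2)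
    (hyq : (q : ℤ) ^ 2 ∣ p ^ l - y ^ 2) :
    (q : ℤ) ^ 4 ≤ 4 * p ^ k ∨ (q : ℤ) ^ 4 ≤ 4 * p ^ l := by
  have hcop : ∀ n, IsCoprime (q : ℤ) ((p : ℤ) ^ n) := fun n ↦
    (Nat.isCoprime_iff_coprime.2 hpq.symm).pow_right
  have hpodd' : Odd (p : ℤ) := by exact_mod_cast hpodd
  have heven : ∀ {n : ℕ} {z : ℤ}, Even n → z ^ 2 < p ^ n → (q : ℤ) ^ 2 ∣ p ^ n - z ^ 2 →
      (q : ℤ) ^ 4 ≤ 4 * p ^ n := by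
    rintro _ z ⟨n, rfl⟩ hz hzq
    have hpn : ((p : ℤ) ^ n) ^ 2 = p ^ (n + n) := by ring
    exact pow_four_le_of_sq_dvd_sub hq hqodd (hcop _) hzq (y := (p : ℤ) ^ n)
      (by rw [hpn, sub_self]; exact dvd_zero _) hz.le hpn.le (by rw [hpn]; exact hz.ne)
  rcases Nat.even_or_odd k with hk | hk
  · exact .inl (heven hk hxk hxq)
  rcases Nat.even_or_odd l with hl | hl
  · exact .inr (heven hl hyl hyq)
  have hne : ∀ {u v : ℤ}, Odd u → Even v → u ^ 2 ≠ v ^ 2 := fun hu hv h ↦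
    Int.not_even_iff_odd.2 (hu.pow (n := 2)) (h ▸ hv.pow_of_ne_zero two_ne_zero)
  have hscale : ∀ {j n : ℕ} {z : ℤ}, z ^ 2 < p ^ n → (q : ℤ) ^ 2 ∣ p ^ n - z ^ 2 →
      (p ^ j * z) ^ 2 ≤ (p : ℤ) ^ (n + 2 * j) ∧
        (q : ℤ) ^ 2 ∣ p ^ (n + 2 * j) - (p ^ j * z) ^ 2 := by
    intro j n z hz hzq
    have h1 : (p : ℤ) ^ (n + 2 * j) - (p ^ j * z) ^ 2 = (p ^ j) ^ 2 * (p ^ n - z ^ 2) := by ring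
    refine ⟨?_, h1 ▸ hzq.mul_left _⟩
    nlinarith [mul_nonneg (sq_nonneg ((p : ℤ) ^ j)) (sub_nonneg.2 hz.le)]
  rcases le_total l k with hlk | hkl
  · obtain ⟨j, rfl⟩ : ∃ j, k = l + 2 * j := by
      obtain ⟨a, ha⟩ := hk
      obtain ⟨b, hb⟩ := hl
      exact ⟨a - b, by omega⟩
    obtain ⟨h1, h2⟩ := hscale (j := j) hyl hyq
    exact .inl (pow_four_le_of_sq_dvd_sub hq hqodd (hcop _) hxq h2 hxk.le h1
      (hne hx (hy.mul_left _)))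
  · obtain ⟨j, rfl⟩ : ∃ j, l = k + 2 * j := by
      obtain ⟨a, ha⟩ := hk
      obtain ⟨b, hb⟩ := hl
      exact ⟨b - a, by omega⟩
    obtain ⟨h1, h2⟩ := hscale (j := j) hxk hxq
    exact .inr (pow_four_le_of_sq_dvd_sub hq hqodd (hcop _) h2 hyq h1 hyl.le
      (hne ((hpodd'.pow).mul hx) hy))

/-- Let `p` be a prime with `p ≡ 1 (mod 4)`, `m > 1` an odd integer
coprime to `p` such that `−1` and `p` are squares mod `m` (with fixed square roots
`i` and `s`), and `q` a prime power dividing `m` with `q ≠ m`. In the non-bipartite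
LPS Ramanujan graph `X_{p,m}` on `PSL₂(ZMod m)` (the Cayley-type graph obtained by
symmetrizing right multiplication by the classes of the `p+1` matrices
`s⁻¹ • ![![x₀+i·x₁, x₂+i·x₃], ![−x₂+i·x₃, x₀−i·x₁]]` coming from the representations
`x₀²+x₁²+x₂²+x₃² = p` with `x₀ > 0` odd and `x₁,x₂,x₃` even), at least one of the
distances from the identity class to the classes of `I′ = ![![1,q],![0,1]]` and
`W = ![![0,1],![−1,0]]` is `≥ log_p (q⁴/4)`; consequently
`(diam : ℝ) ≥ log_p (q⁴/4)`. -/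
theorem lps_nonbipartite_diameter_lower_bound
    (p m q : ℕ) (hp : p.Prime) (hp4 : p % 4 = 1)
    (hm1 : 1 < m) (hmodd : Odd m) (hcop : Nat.Coprime p m)
    (i s : ZMod m) (hi : i ^ 2 = -1) (hs : s ^ 2 = (p : ZMod m))
    (hq : IsPrimePow q) (hqm : q ∣ m) (hqne : q ≠ m)
    (X : SimpleGraph
      (SpecialLinearGroup (Fin 2) (ZMod m) ⧸
        Subgroup.center (SpecialLinearGroup (Fin 2) (ZMod m))))
    (hX : X = SimpleGraph.fromRel (fun x y =>
      ∃ (A : SpecialLinearGroup (Fin 2) (ZMod m)) (x₀ x₁ x₂ x₃ : ℤ),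
        x₀ ^ 2 + x₁ ^ 2 + x₂ ^ 2 + x₃ ^ 2 = (p : ℤ) ∧ 0 < x₀ ∧ Odd x₀ ∧
        Even x₁ ∧ Even x₂ ∧ Even x₃ ∧
        (A : Matrix (Fin 2) (Fin 2) (ZMod m)) =
          s⁻¹ •
            !![(x₀ : ZMod m) + i * (x₁ : ZMod m), (x₂ : ZMod m) + i * (x₃ : ZMod m);
               -(x₂ : ZMod m) + i * (x₃ : ZMod m), (x₀ : ZMod m) - i * (x₁ : ZMod m)] ∧
        y = x * QuotientGroup.mk A))
    (I' W : SpecialLinearGroup (Fin 2) (ZMod m))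
    (hI' : (I' : Matrix (Fin 2) (Fin 2) (ZMod m)) = !![1, (q : ZMod m); 0, 1])
    (hW : (W : Matrix (Fin 2) (Fin 2) (ZMod m)) = !![0, 1; -1, 0]) :
    ((X.dist 1 (QuotientGroup.mk I') : ℝ) ≥ Real.logb p ((q : ℝ) ^ 4 / 4) ∨
      (X.dist 1 (QuotientGroup.mk W) : ℝ) ≥ Real.logb p ((q : ℝ) ^ 4 / 4)) ∧
    (X.diam : ℝ) ≥ Real.logb p ((q : ℝ) ^ 4 / 4) := by
  have hpu : IsUnit (p : ZMod m) := (ZMod.isUnit_iff_coprime p m).2 hcop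
  have hsu : IsUnit s := (isUnit_pow_iff two_ne_zero).1 (hs ▸ hpu)
  have hs' : s⁻¹ ^ 2 * p = 1 := by
    rw [← hs, ← mul_pow, ZMod.inv_mul_of_unit s hsu, one_pow]
  have hadj : ∀ x y, X.Adj x y ↔
      x ≠ y ∧ (IsLpsGenerator p i s (x⁻¹ * y) ∨ IsLpsGenerator p i s (y⁻¹ * x)) := by
    have hrel : ∀ x y, (∃ (A : SpecialLinearGroup (Fin 2) (ZMod m)) (x₀ x₁ x₂ x₃ : ℤ),
        x₀ ^ 2 + x₁ ^ 2 + x₂ ^ 2 + x₃ ^ 2 = (p : ℤ) ∧ 0 < x₀ ∧ Odd x₀ ∧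
        Even x₁ ∧ Even x₂ ∧ Even x₃ ∧
        (A : Matrix (Fin 2) (Fin 2) (ZMod m)) =
          s⁻¹ •
            !![(x₀ : ZMod m) + i * (x₁ : ZMod m), (x₂ : ZMod m) + i * (x₃ : ZMod m);
               -(x₂ : ZMod m) + i * (x₃ : ZMod m), (x₀ : ZMod m) - i * (x₁ : ZMod m)] ∧
        y = x * QuotientGroup.mk A) ↔ IsLpsGenerator p i s (x⁻¹ * y) := by
      intro x y
      constructor
      · rintro ⟨A, x₀, x₁, x₂, x₃, hn, hpos, h0, h1, h2, h3, hA, rfl⟩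
        exact ⟨ofCoords x₀ x₁ x₂ x₃, A, ⟨h0, h1, h2, h3⟩, hpos,
          by rw [normSq_def', ← hn]; rfl, hA, by simp⟩
      · rintro ⟨a, A, ⟨h0, h1, h2, h3⟩, hpos, hn, hA, hxy⟩
        exact ⟨A, a.re, a.imI, a.imJ, a.imK, by rw [← hn, normSq_def'], hpos, h0, h1, h2, h3, hA,
          by rw [← hxy, mul_inv_cancel_left]⟩
    intro x y
    rw [hX, SimpleGraph.fromRel_adj, hrel, hrel]
  have hconn := lpsGraph_connected hp hp4 hm1 hmodd hcop hi hs' hadj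
  have hclass : ∀ g, IsLpsClass p i s (X.dist 1 g) g := by
    intro g
    obtain ⟨w, hw⟩ := (hconn.preconnected 1 g).exists_walk_length_eq_dist
    simpa [hw] using isLpsClass_of_walk hi hadj w
  obtain rfl : I' = upper (q : ZMod m) := Subtype.ext hI'
  obtain ⟨x, hx, hxk, hxq⟩ :=
    (hclass (QuotientGroup.mk (upper (q : ZMod m)))).exists_odd_of_upper hmodd hcop hi hs' hqm
      hqne
  obtain ⟨y, hy, hyl, hyq⟩ :=
    (hclass (QuotientGroup.mk W)).exists_even_of_weyl hmodd hi hs' hqm hW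
  have hlog : ∀ n : ℕ, (q : ℤ) ^ 4 ≤ 4 * p ^ n → (n : ℝ) ≥ Real.logb p ((q : ℝ) ^ 4 / 4) := by
    intro n hn
    have hn' : (q : ℝ) ^ 4 ≤ 4 * p ^ n := by exact_mod_cast hn
    have hq0 : (0 : ℝ) < q := by exact_mod_cast hq.pos
    rw [ge_iff_le, Real.logb_le_iff_le_rpow (by exact_mod_cast hp.one_lt) (by positivity),
      Real.rpow_natCast]
    linarith
  have hdist := (pow_four_le_or_of_odd_of_even (Nat.odd_iff.2 (by omega)) hq
    (hmodd.of_dvd_nat hqm) (hcop.coprime_dvd_right hqm) hx hy hxk hyl hxq hyq).imp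
    (hlog _) (hlog _)
  refine ⟨hdist, ?_⟩
  have : NeZero m := ⟨by omega⟩
  have hdiam := SimpleGraph.connected_iff_ediam_ne_top.1 hconn
  rcases hdist with h | h
  · exact le_trans h (by exact_mod_cast SimpleGraph.dist_le_diam hdiam)
  · exact le_trans h (by exact_mod_cast SimpleGraph.dist_le_diam hdiam)
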